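/- Let A_1 = (1, 2, 3, 4, 5, …) be the sequence of consecutive positive integers (a_i = i) and let k ≥ 5 be an integer. Then for every integer n > 432·k^{k+5}·(k−1)!·e^{1/k}, one has p_{A_1}(n,k)² > p_{A_1}(n+1,k)·p_{A_1}(n−1,k). -/

import Mathlib

/-- The restricted partition function `p_A(n,k)` for the sequence `a` (0-indexed, so the
paper's `a_i` is `a (i-1)`): the number of `k`-tuples `(c_0,…,c_{k-1})` of nonnegative
integers with `c_0·a_0 + ⋯ + c_{k-1}·a_{k-1} = n`.
It equals `0` for `n < 0` and `1` for `n = 0`. -/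
noncomputable def pA (a : ℕ → ℕ) (k : ℕ) (n : ℤ) : ℕ :=
  Set.ncard {c : Fin k → ℕ | (∑ i, (c i : ℤ) * (a i.val : ℤ)) = n}

/-- The number of partitions of `n` into parts of size at most `k`, as a real number. -/
noncomputable def partsCount (k : ℕ) (n : ℤ) : ℝ := (pA (fun i => i + 1) k n : ℝ)

theorem pA_setOf_finite (k : ℕ) (n : ℤ) :
    {c : Fin k → ℕ | (∑ i, (c i : ℤ) * ((i.val + 1 : ℕ) : ℤ)) = n}.Finite := by
  refine (Set.finite_Iic (fun _ : Fin k => n.toNat)).subset ?_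
  intro c hc i
  have hc' : (∑ i, (c i : ℤ) * ((i.val + 1 : ℕ) : ℤ)) = n := hc
  have h1 : (c i : ℤ) * ((i.val + 1 : ℕ) : ℤ) ≤ n := by
    rw [← hc']
    exact Finset.single_le_sum (f := fun i : Fin k => (c i : ℤ) * ((i.val + 1 : ℕ) : ℤ))
      (fun j _ => by positivity) (Finset.mem_univ i)
  have h2 : (c i : ℤ) ≤ (c i : ℤ) * ((i.val + 1 : ℕ) : ℤ) := by
    push_cast
    nlinarith [Int.natCast_nonneg (c i), Int.natCast_nonneg i.val]
  show c i ≤ n.toNat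
  omega

theorem pA_succ (k : ℕ) (n : ℤ) :
    pA (fun i => i + 1) (k + 1) n =
      pA (fun i => i + 1) k n + pA (fun i => i + 1) (k + 1) (n - (k + 1)) := by
  unfold pA
  have hinj0 : Function.Injective (fun c : Fin k → ℕ => (Fin.snoc c 0 : Fin (k + 1) → ℕ)) := by
    intro c d h
    exact (Fin.snoc_inj.1 h).1
  have hinj1 : Function.Injective
      (fun c : Fin (k + 1) → ℕ =>
        (Fin.snoc (Fin.init c) (c (Fin.last k) + 1) : Fin (k + 1) → ℕ)) := by
    intro c d h
    obtain ⟨h1, h2⟩ := Fin.snoc_inj.1 h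
    rw [← Fin.snoc_init_self c, ← Fin.snoc_init_self d, h1, Nat.succ_injective h2]
  rw [← Set.ncard_image_of_injective {c : Fin k → ℕ | _} hinj0,
    ← Set.ncard_image_of_injective {c : Fin (k + 1) → ℕ | _ = n - (k + 1)} hinj1,
    ← Set.ncard_union_eq ?_ ((pA_setOf_finite k n).image _)
      ((pA_setOf_finite (k + 1) (n - (k + 1))).image _)]
  · congr 1
    ext c
    simp only [Set.mem_ofPred_eq, Set.mem_union, Set.mem_image]
    constructor
    · intro h
      rw [Fin.sum_univ_castSucc] at h
      rcases hc : c (Fin.last k) with _ | m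
      · left
        refine ⟨Fin.init c, ?_, ?_⟩
        · simpa [hc, Fin.init] using h
        · rw [← hc, Fin.snoc_init_self]
      · right
        refine ⟨Fin.snoc (Fin.init c) m, ?_, ?_⟩
        · rw [Fin.sum_univ_castSucc]
          simp only [Fin.snoc_castSucc, Fin.snoc_last, Fin.init, Fin.val_castSucc, Fin.val_last]
          simp only [hc, Fin.val_castSucc, Fin.val_last] at h
          push_cast at h ⊢
          linarith
        · simp only [Fin.init_snoc, Fin.snoc_last]
          rw [← hc, Fin.snoc_init_self]
    · rintro (⟨d, hd, rfl⟩ | ⟨d, hd, rfl⟩)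
      · rw [Fin.sum_univ_castSucc]
        simpa using hd
      · rw [Fin.sum_univ_castSucc] at hd ⊢
        simp only [Fin.snoc_castSucc, Fin.snoc_last, Fin.init, Fin.val_castSucc,
          Fin.val_last] at hd ⊢
        push_cast at hd ⊢
        linarith
  · rw [Set.disjoint_left]
    rintro _ ⟨c, _, rfl⟩ ⟨d, _, h⟩
    have := (Fin.snoc_inj.1 h).2
    omega

theorem partsCount_succ (k : ℕ) (n : ℤ) :
    partsCount (k + 1) n = partsCount k n + partsCount (k + 1) (n - (k + 1)) := by
  unfold partsCount
  exact_mod_cast pA_succ k n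

theorem partsCount_of_neg (k : ℕ) {n : ℤ} (hn : n < 0) : partsCount k n = 0 := by
  have h : {c : Fin k → ℕ | (∑ i, (c i : ℤ) * ((i.val + 1 : ℕ) : ℤ)) = n} = ∅ := by
    ext c
    simp only [Set.mem_ofPred_eq, Set.mem_empty_iff_false, iff_false]
    have : 0 ≤ ∑ i, (c i : ℤ) * ((i.val + 1 : ℕ) : ℤ) :=
      Finset.sum_nonneg fun i _ => by positivity
    omega
  unfold partsCount pA
  rw [h]
  simp

theorem partsCount_zero (n : ℤ) : partsCount 0 n = if n = 0 then 1 else 0 := by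
  unfold partsCount pA
  split_ifs with h
  · subst h
    simp
  · simp [Ne.symm h]

theorem partsCount_nonneg (k : ℕ) (n : ℤ) : 0 ≤ partsCount k n := Nat.cast_nonneg _

/-- The backward difference of `partsCount k`. -/
noncomputable def partsDiff (k : ℕ) (n : ℤ) : ℝ := partsCount k n - partsCount k (n - 1)

/-- The second backward difference of `partsCount k`. -/
noncomputable def partsDiff₂ (k : ℕ) (n : ℤ) : ℝ := partsDiff k n - partsDiff k (n - 1)

theorem partsDiff_succ (k : ℕ) (n : ℤ) :
    partsDiff (k + 1) n = partsDiff k n + partsDiff (k + 1) (n - (k + 1)) := by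
  unfold partsDiff
  rw [partsCount_succ k n, partsCount_succ k (n - 1),
    show n - 1 - ((k : ℤ) + 1) = n - (k + 1) - 1 by ring]
  ring

theorem partsDiff₂_succ (k : ℕ) (n : ℤ) :
    partsDiff₂ (k + 1) n = partsDiff₂ k n + partsDiff₂ (k + 1) (n - (k + 1)) := by
  unfold partsDiff₂
  rw [partsDiff_succ k n, partsDiff_succ k (n - 1),
    show n - 1 - ((k : ℤ) + 1) = n - (k + 1) - 1 by ring]
  ring

theorem partsDiff_of_neg (k : ℕ) {n : ℤ} (hn : n < 0) : partsDiff k n = 0 := by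
  unfold partsDiff
  rw [partsCount_of_neg k hn, partsCount_of_neg k (by omega), sub_zero]

theorem partsDiff₂_of_neg (k : ℕ) {n : ℤ} (hn : n < 0) : partsDiff₂ k n = 0 := by
  unfold partsDiff₂
  rw [partsDiff_of_neg k hn, partsDiff_of_neg k (by omega), sub_zero]

theorem pow_succ_add_le_add_pow {t b : ℝ} (ht : 0 ≤ t) (htb : 0 ≤ t + b) (d : ℕ) :
    t ^ (d + 1) + (d + 1) * b * t ^ d ≤ (t + b) ^ (d + 1) := by
  induction d with
  | zero => simp
  | succ d ih =>
    have h := mul_le_mul_of_nonneg_left ih htb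
    have h2 : 0 ≤ ((d : ℝ) + 1) * b ^ 2 * t ^ d := by positivity
    push_cast
    calc t ^ (d + 1 + 1) + ((d : ℝ) + 1 + 1) * b * t ^ (d + 1)
        ≤ t ^ (d + 1 + 1) + ((d : ℝ) + 1 + 1) * b * t ^ (d + 1) +
          ((d : ℝ) + 1) * b ^ 2 * t ^ d := by linarith
      _ = (t + b) * (t ^ (d + 1) + (d + 1) * b * t ^ d) := by ring
      _ ≤ (t + b) * (t + b) ^ (d + 1) := h
      _ = (t + b) ^ (d + 1 + 1) := by ring

/-- Induction on the integers in steps of `a`, starting from the negative ones. -/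
theorem int_step_induction {a : ℤ} (ha : 0 < a) {Q : ℤ → Prop} (hneg : ∀ n < 0, Q n)
    (hstep : ∀ n, 0 ≤ n → Q (n - a) → Q n) (n : ℤ) : Q n := by
  have key : ∀ m : ℕ, ∀ n : ℤ, n < m → Q n := by
    intro m
    induction m with
    | zero => exact fun n hn => hneg n (by simpa using hn)
    | succ m ih =>
      intro n hn
      rcases lt_or_ge n 0 with h | h
      · exact hneg n h
      · exact hstep n h (ih _ (by push_cast at hn; omega))
  exact key (n.toNat + 1) n (by omega)

theorem upper_bound_step {f g : ℤ → ℝ} {a : ℕ} (ha : 0 < a) {c s : ℝ} {d : ℕ} (hc : 0 ≤ c)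
    (hs : 0 ≤ s) (hg : ∀ n, g n = f n + g (n - a)) (hneg : ∀ n < 0, g n = 0)
    (hf : ∀ n : ℤ, 0 ≤ n → f n ≤ c * (n + s) ^ d) (n : ℤ) (hn : 0 ≤ n) :
    g n ≤ c / (a * (d + 1)) * (n + s + a) ^ (d + 1) := by
  have ha' : (0 : ℝ) < a := by exact_mod_cast ha
  have hC : 0 ≤ c / (a * (d + 1)) := by positivity
  induction n using int_step_induction (a := (a : ℤ)) (by exact_mod_cast ha) with
  | hneg n h => omega
  | hstep n _ ih =>
    have hn' : (0 : ℝ) ≤ n := by exact_mod_cast hn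
    have h1 : g (n - a) ≤ c / (a * (d + 1)) * (n + s) ^ (d + 1) := by
      rcases lt_or_ge (n - a : ℤ) 0 with h | h
      · rw [hneg _ h]
        positivity
      · have := ih h
        push_cast at this
        rwa [show (n : ℝ) - a + s + a = n + s by ring] at this
    have h2 := mul_le_mul_of_nonneg_left
      (pow_succ_add_le_add_pow (t := n + s) (b := a) (by positivity) (by positivity) d) hC
    have h3 : c / (a * (d + 1)) * ((d + 1) * a * (n + s) ^ d) = c * (n + s) ^ d := by
      field_simp
    rw [hg n]
    linarith [hf n hn]

theorem lower_bound_step {f g : ℤ → ℝ} {a : ℕ} (ha : 0 < a) {c s : ℝ} {d : ℕ} (hc : 0 ≤ c)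
    (hs : 0 ≤ s) (hg : ∀ n, g n = f n + g (n - a)) (hneg : ∀ n < 0, g n = 0)
    (hf : ∀ n : ℤ, c * (max (n - s) 0) ^ d ≤ f n) (n : ℤ) :
    c / (a * (d + 1)) * (max (n - s) 0) ^ (d + 1) ≤ g n := by
  have ha' : (0 : ℝ) < a := by exact_mod_cast ha
  have hC : 0 ≤ c / (a * (d + 1)) := by positivity
  induction n using int_step_induction (a := (a : ℤ)) (by exact_mod_cast ha) with
  | hneg n h =>
    have : (n : ℝ) < 0 := by exact_mod_cast h
    rw [hneg n h, max_eq_right (by linarith)]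
    simp
  | hstep n _ ih =>
    have key : (max ((n : ℝ) - s) 0) ^ (d + 1) ≤
        (d + 1) * a * (max ((n : ℝ) - s) 0) ^ d + (max ((n : ℝ) - s - a) 0) ^ (d + 1) := by
      have ht : 0 ≤ max ((n : ℝ) - s) 0 := le_max_right _ _
      rcases le_total (a : ℝ) (n - s) with h | h
      · rw [max_eq_left (by linarith), max_eq_left (by linarith)]
        have := pow_succ_add_le_add_pow (t := (n : ℝ) - s) (b := -a) (by linarith)
          (by linarith) d
        rw [← sub_eq_add_neg] at this
        linarith
      · have h1 : max ((n : ℝ) - s) 0 ≤ (d + 1) * a := by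
          have : (0 : ℝ) ≤ d * a := by positivity
          refine max_le ?_ ?_ <;> linarith
        have h2 := mul_le_mul_of_nonneg_right h1 (pow_nonneg ht d)
        have h3 : 0 ≤ (max ((n : ℝ) - s - a) 0) ^ (d + 1) := by positivity
        rw [pow_succ']
        linarith
    have h2 := mul_le_mul_of_nonneg_left key hC
    have h3 : c / (a * (d + 1)) * ((d + 1) * a * (max ((n : ℝ) - s) 0) ^ d) =
        c * (max ((n : ℝ) - s) 0) ^ d := by
      field_simp
    push_cast at ih
    rw [show (n : ℝ) - a - s = n - s - a by ring] at ih
    rw [hg n]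
    linarith [hf n]

theorem partsCount_le (j : ℕ) (n : ℤ) (hn : 0 ≤ n) :
    partsCount (j + 1) n ≤
      1 / (j.factorial * (j + 1).factorial) * (n + ((j : ℝ) + 1) ^ 2) ^ j := by
  induction j generalizing n with
  | zero =>
    have h : ∀ n : ℤ, partsCount 1 n ≤ 1 := by
      intro n
      induction n using int_step_induction (a := 1) one_pos with
      | hneg n h => simp [partsCount_of_neg 1 h]
      | hstep n h ih =>
        have h1 := partsCount_succ 0 n
        rw [partsCount_zero] at h1
        simp only [Nat.cast_zero, zero_add] at h1
        split_ifs at h1 with h0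
        · rw [h1, partsCount_of_neg 1 (by omega)]
          simp
        · linarith
    simpa using h n
  | succ j ih =>
    have h := upper_bound_step (a := j + 2) (by omega) (by positivity) (by positivity)
      (fun n => by simpa [add_assoc, one_add_one_eq_two] using partsCount_succ (j + 1) n)
      (fun n hn => partsCount_of_neg (j + 1 + 1) hn) ih n hn
    refine h.trans ?_
    have hn' : (0 : ℝ) ≤ n := by exact_mod_cast hn
    have hj : (0 : ℝ) ≤ j := by positivity
    rw [show (1 : ℝ) / (j.factorial * (j + 1).factorial) / (((j + 2 : ℕ) : ℝ) * (j + 1)) =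
      1 / ((j + 1).factorial * (j + 1 + 1).factorial) by
        rw [Nat.factorial_succ (j + 1), Nat.factorial_succ j]; push_cast; field_simp; ring]
    gcongr ?_ * ?_ ^ _
    push_cast
    nlinarith

theorem partsDiff_two (n : ℤ) : partsDiff 2 n = if 0 ≤ n ∧ n % 2 = 0 then 1 else 0 := by
  induction n using int_step_induction (a := 2) two_pos with
  | hneg n h =>
    rw [partsDiff_of_neg 2 h, if_neg (by omega)]
  | hstep n h ih =>
    have h1 := partsDiff_succ 1 n
    have h2 : partsDiff 1 n = partsCount 0 n := by
      have := partsCount_succ 0 n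
      simp only [Nat.cast_zero, zero_add] at this
      unfold partsDiff
      linarith
    rw [h2, partsCount_zero] at h1
    norm_num at h1
    rw [h1, ih]
    rcases eq_or_ne n 0 with rfl | h0
    · norm_num
    · rcases eq_or_ne n 1 with rfl | h1
      · norm_num
      · rw [if_neg h0, zero_add]
        congr 1
        apply propext
        omega

theorem le_partsDiff_three (n : ℤ) : 1 / 6 * (max ((n : ℝ) - 6) 0) ≤ partsDiff 3 n := by
  have hrec : ∀ n, partsDiff 3 n = partsDiff 2 n + partsDiff 2 (n - 3) + partsDiff 3 (n - 6) := by
    intro n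
    have h1 := partsDiff_succ 2 n
    have h2 := partsDiff_succ 2 (n - 3)
    norm_num at h1 h2
    rw [h1, h2, show n - 3 - 3 = n - 6 by ring]
    ring
  induction n using int_step_induction (a := 6) (by norm_num) with
  | hneg n h =>
    have : (n : ℝ) < 0 := by exact_mod_cast h
    rw [partsDiff_of_neg 3 h, max_eq_right (by linarith)]
    simp
  | hstep n h ih =>
    have h0 : 0 ≤ partsDiff 3 (n - 6) := le_trans (by positivity) ih
    rw [hrec n, partsDiff_two, partsDiff_two]
    rcases lt_or_ge n 6 with h6 | h6
    · have : (n : ℝ) < 6 := by exact_mod_cast h6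
      rw [max_eq_right (by linarith)]
      have e1 : (0 : ℝ) ≤ if 0 ≤ n ∧ n % 2 = 0 then 1 else 0 := by split_ifs <;> norm_num
      have e2 : (0 : ℝ) ≤ if 0 ≤ n - 3 ∧ (n - 3) % 2 = 0 then 1 else 0 := by
        split_ifs <;> norm_num
      linarith
    · have h6' : (6 : ℝ) ≤ n := by exact_mod_cast h6
      have e : ((if 0 ≤ n ∧ n % 2 = 0 then 1 else 0 : ℝ) +
          if 0 ≤ n - 3 ∧ (n - 3) % 2 = 0 then 1 else 0) = 1 := by
        rcases Int.emod_two_eq_zero_or_one n with hp | hp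
        · rw [if_pos (by omega), if_neg (by omega), add_zero]
        · rw [if_neg (by omega), if_pos (by omega), zero_add]
      rw [e, max_eq_left (by linarith)]
      push_cast at ih
      have := le_max_left ((n : ℝ) - 6 - 6) 0
      linarith

theorem le_partsDiff (j : ℕ) (n : ℤ) :
    1 / ((j + 1).factorial * (j + 3).factorial) * (max ((n : ℝ) - 6) 0) ^ (j + 1) ≤
      partsDiff (j + 3) n := by
  induction j generalizing n with
  | zero =>
    have := le_partsDiff_three n
    norm_num [Nat.factorial] at this ⊢
    exact this
  | succ j ih =>
    have h := lower_bound_step (a := j + 4) (by omega) (by positivity) (by positivity)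
      (fun n => by
        have := partsDiff_succ (j + 3) n
        push_cast at this ⊢
        rwa [show (j : ℤ) + 3 + 1 = j + 4 by ring] at this)
      (fun n hn => partsDiff_of_neg (j + 3 + 1) hn) ih n
    rw [show (1 : ℝ) / ((j + 1).factorial * (j + 3).factorial) /
      (((j + 4 : ℕ) : ℝ) * ((j + 1 : ℕ) + 1)) =
      1 / ((j + 1 + 1).factorial * (j + 3 + 1).factorial) by
        rw [Nat.factorial_succ (j + 3), Nat.factorial_succ (j + 1)]; push_cast; field_simp
        ring] at h
    exact h

/-- The coefficients of `(1 - x + x²) / (1 - x⁵)`. -/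
noncomputable def altCoeff (n : ℤ) : ℝ :=
  if n < 0 then 0 else if n % 5 = 0 then 1 else if n % 5 = 1 then -1 else
    if n % 5 = 2 then 1 else 0

/-- The generating function of the left side is `(1 - x + x²) / ((1 - x⁴) (1 - x⁵))`. -/
theorem partsDiff₂_five_sub (n : ℤ) :
    (partsDiff₂ 5 n - partsDiff₂ 5 (n - 6)) -
      (partsDiff₂ 5 (n - 4) - partsDiff₂ 5 (n - 10)) = altCoeff n := by
  induction n using int_step_induction (a := 5) (by norm_num) with
  | hneg n h =>
    rw [partsDiff₂_of_neg 5 h, partsDiff₂_of_neg 5 (by omega), partsDiff₂_of_neg 5 (by omega),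
      partsDiff₂_of_neg 5 (by omega), altCoeff, if_pos h]
    simp
  | hstep n h ih =>
    have h5 : ∀ m, partsDiff₂ 5 m = partsDiff₂ 4 m + partsDiff₂ 5 (m - 5) := fun m => by
      simpa using partsDiff₂_succ 4 m
    have h4 : ∀ m, partsDiff₂ 4 m = partsDiff₂ 3 m + partsDiff₂ 4 (m - 4) := fun m => by
      simpa using partsDiff₂_succ 3 m
    have h3 : ∀ m, partsDiff₂ 3 m = partsDiff₂ 2 m + partsDiff₂ 3 (m - 3) := fun m => by
      simpa using partsDiff₂_succ 2 m
    have h2 : ∀ m, partsDiff₂ 2 m = partsDiff 2 m - partsDiff 2 (m - 1) := fun m => rfl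
    have e : partsDiff₂ 3 n - partsDiff₂ 3 (n - 6) = altCoeff n - altCoeff (n - 5) := by
      have a1 := h3 n
      have a2 := h3 (n - 3)
      rw [h2, show n - 3 - 3 = n - 6 by ring] at a2
      rw [h2] at a1
      rw [a1, a2]
      simp only [partsDiff_two, altCoeff]
      rcases lt_or_ge n 5 with hn | hn
      · interval_cases n <;> norm_num
      · have hb : ∀ m : ℤ, 0 ≤ m → (if 0 ≤ m ∧ m % 2 = 0 then (1 : ℝ) else 0) =
            if m % 2 = 0 then 1 else 0 := fun m hm => by simp [hm]
        rw [hb n (by omega), hb (n - 1) (by omega), hb (n - 3) (by omega),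
          hb (n - 3 - 1) (by omega), if_neg (by omega : ¬ n < 0),
          if_neg (by omega : ¬ n - 5 < 0),
          show (n - 5) % 5 = n % 5 by omega, show (n - 3) % 2 = (n - 1) % 2 by omega,
          show (n - 3 - 1) % 2 = n % 2 by omega]
        ring
    have b0 := h5 n
    have b1 := h5 (n - 6)
    have b2 := h5 (n - 4)
    have b3 := h5 (n - 10)
    have c0 := h4 n
    have c1 := h4 (n - 6)
    rw [show n - 6 - 4 = n - 10 by ring] at c1
    rw [show n - 6 - 5 = n - 5 - 6 by ring] at b1
    rw [show n - 4 - 5 = n - 5 - 4 by ring] at b2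
    rw [show n - 10 - 5 = n - 5 - 10 by ring] at b3
    linarith

theorem altCoeff_le_one (n : ℤ) : altCoeff n ≤ 1 := by
  unfold altCoeff
  split_ifs <;> norm_num

theorem altCoeff_sum {n : ℤ} (hn : 16 ≤ n) :
    altCoeff n + altCoeff (n - 4) + altCoeff (n - 8) + altCoeff (n - 12) +
      altCoeff (n - 16) = 1 := by
  have hpos : ∀ m : ℤ, 0 ≤ m → altCoeff m =
      if m % 5 = 0 then 1 else if m % 5 = 1 then -1 else if m % 5 = 2 then 1 else 0 :=
    fun m hm => if_neg (by omega)
  rw [hpos n (by omega), hpos (n - 4) (by omega), hpos (n - 8) (by omega),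
    hpos (n - 12) (by omega), hpos (n - 16) (by omega), show (n - 4) % 5 = (n + 1) % 5 by omega,
    show (n - 8) % 5 = (n + 2) % 5 by omega, show (n - 12) % 5 = (n + 3) % 5 by omega,
    show (n - 16) % 5 = (n + 4) % 5 by omega]
  have h : n % 5 = 0 ∨ n % 5 = 1 ∨ n % 5 = 2 ∨ n % 5 = 3 ∨ n % 5 = 4 := by omega
  rcases h with h | h | h | h | h <;> simp [Int.add_emod, h]

theorem partsDiff₂_five_sub_le (n : ℤ) (hn : 0 ≤ n) :
    partsDiff₂ 5 n - partsDiff₂ 5 (n - 6) ≤ 1 / 20 * (n + 100) ^ 1 := by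
  set V : ℤ → ℝ := fun n => partsDiff₂ 5 n - partsDiff₂ 5 (n - 6) with hV
  have hrec : ∀ n, V n = altCoeff n + V (n - 4) := by
    intro n
    have := partsDiff₂_five_sub n
    simp only [hV]
    rw [show n - 4 - 6 = n - 10 by ring]
    linarith
  have hneg : ∀ n < 0, V n = 0 := by
    intro n hn
    simp only [hV]
    rw [partsDiff₂_of_neg 5 hn, partsDiff₂_of_neg 5 (by omega), sub_zero]
  have hfive : ∀ n, V n = altCoeff n + altCoeff (n - 4) + altCoeff (n - 8) +
      altCoeff (n - 12) + altCoeff (n - 16) + V (n - 20) := by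
    intro n
    rw [hrec n, hrec (n - 4), show n - 4 - 4 = n - 8 by ring, hrec (n - 8),
      show n - 8 - 4 = n - 12 by ring, hrec (n - 12), show n - 12 - 4 = n - 16 by ring,
      hrec (n - 16), show n - 16 - 4 = n - 20 by ring]
    ring
  change V n ≤ _
  rw [pow_one]
  induction n using int_step_induction (a := 20) (by norm_num) with
  | hneg n h => omega
  | hstep n _ ih =>
    have hn' : (0 : ℝ) ≤ n := by exact_mod_cast hn
    rw [hfive n]
    rcases lt_or_ge n 20 with h | h
    · rw [hneg (n - 20) (by omega)]
      linarith [altCoeff_le_one n, altCoeff_le_one (n - 4), altCoeff_le_one (n - 8),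
        altCoeff_le_one (n - 12), altCoeff_le_one (n - 16)]
    · have := ih (by omega)
      push_cast at this
      rw [altCoeff_sum (by omega)]
      linarith

theorem partsDiff₂_le (j : ℕ) (n : ℤ) (hn : 0 ≤ n) :
    partsDiff₂ (j + 5) n ≤
      1 / ((j + 2).factorial * (j + 5).factorial) *
        (n + (100 + ((j : ℝ) + 5) ^ 2)) ^ (j + 2) := by
  induction j generalizing n with
  | zero =>
    have h := upper_bound_step (a := 6) (g := partsDiff₂ 5) (by norm_num) (by norm_num)
      (by norm_num) (fun n => (sub_add_cancel _ _).symm) (fun n hn => partsDiff₂_of_neg 5 hn)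
      partsDiff₂_five_sub_le n hn
    have hn' : (0 : ℝ) ≤ n := by exact_mod_cast hn
    refine h.trans ?_
    norm_num [Nat.factorial]
    nlinarith
  | succ j ih =>
    have h := upper_bound_step (a := j + 6) (by omega) (by positivity) (by positivity)
      (fun n => by
        have := partsDiff₂_succ (j + 5) n
        push_cast at this ⊢
        rwa [show (j : ℤ) + 5 + 1 = j + 6 by ring] at this)
      (fun n hn => partsDiff₂_of_neg (j + 5 + 1) hn) ih n hn
    rw [show (1 : ℝ) / ((j + 2).factorial * (j + 5).factorial) /
      (((j + 6 : ℕ) : ℝ) * ((j + 2 : ℕ) + 1)) =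
      1 / ((j + 2 + 1).factorial * (j + 5 + 1).factorial) by
        rw [Nat.factorial_succ (j + 5), Nat.factorial_succ (j + 2)]; push_cast; field_simp
        ring] at h
    have hn' : (0 : ℝ) ≤ n := by exact_mod_cast hn
    have hj : (0 : ℝ) ≤ j := by positivity
    rw [show j + 1 + 2 = j + 2 + 1 by ring, show j + 1 + 5 = j + 5 + 1 by ring]
    refine h.trans ?_
    gcongr ?_ * ?_ ^ _
    push_cast
    nlinarith

/-- The shifts in the bounds for the counting function and its differences do not affect the
comparison of the main terms. -/
theorem mul_add_pow_lt_mul_sub_pow {c t b : ℝ} {M : ℕ} (hc : 0 < c) (hb : 0 ≤ b) (hbt : b ≤ t)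
    (h : 2 * b * (M + 1) * (c + 1) < t + b) :
    c * (t + b) ^ (M + 1) < (c + 1) * (t - b) ^ (M + 1) := by
  have hM : (0 : ℝ) ≤ M := by positivity
  have hpos : 0 < t + b := lt_of_le_of_lt (by positivity) h
  have h1 := pow_succ_add_le_add_pow (t := t + b) (b := -(2 * b)) hpos.le (by linarith) M
  rw [show t + b + -(2 * b) = t - b by ring] at h1
  have h2 : 0 < (t + b) ^ M * (t + b - 2 * b * (M + 1) * (c + 1)) :=
    mul_pos (by positivity) (by linarith)
  have h3 := mul_le_mul_of_nonneg_left h1 (by linarith : 0 ≤ c + 1)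
  have h4 : (c + 1) * ((t + b) ^ (M + 1) + (M + 1) * -(2 * b) * (t + b) ^ M) =
      c * (t + b) ^ (M + 1) + (t + b) ^ M * (t + b - 2 * b * (M + 1) * (c + 1)) := by ring
  linarith

theorem partsCount_mul_lt_sq (j : ℕ) (n : ℤ) (hn : 40 * ((j : ℝ) + 5) ^ 4 ≤ n) :
    partsCount (j + 5) (n + 1) * partsCount (j + 5) (n - 1) < partsCount (j + 5) n ^ 2 := by
  have hj : (0 : ℝ) ≤ j := by positivity
  set b : ℝ := 10 * ((j : ℝ) + 5) ^ 2 with hb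
  have hb0 : 0 ≤ b := by positivity
  have hb250 : 250 ≤ b := by nlinarith
  have hbn : b ≤ n := by nlinarith [sq_nonneg ((j : ℝ) + 5)]
  have hn0 : 0 ≤ n := by
    have : (0 : ℝ) ≤ n := by linarith
    exact_mod_cast this
  have hP : partsCount (j + 5) n ≤
      1 / ((j + 4).factorial * (j + 5).factorial) * (n + b) ^ (j + 4) := by
    refine (partsCount_le (j + 4) n hn0).trans ?_
    gcongr ?_ * ?_ ^ _
    push_cast
    nlinarith
  have hS : partsDiff₂ (j + 5) (n + 1) ≤
      1 / ((j + 2).factorial * (j + 5).factorial) * (n + b) ^ (j + 2) := by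
    refine (partsDiff₂_le j (n + 1) (by omega)).trans ?_
    have : (0 : ℝ) ≤ n := by linarith
    gcongr ?_ * ?_ ^ _
    push_cast
    nlinarith
  have hq : ∀ m : ℤ, n ≤ m → 1 / ((j + 3).factorial * (j + 5).factorial) * (n - b) ^ (j + 3) ≤
      partsDiff (j + 5) m := by
    intro m hm
    refine le_trans ?_ (le_partsDiff (j + 2) m)
    have hm' : (n : ℝ) ≤ m := by exact_mod_cast hm
    have : (0 : ℝ) ≤ n - b := by linarith
    gcongr ?_ * ?_ ^ _
    exact le_max_of_le_left (by linarith)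
  have hnb : (0 : ℝ) ≤ n - b := by linarith
  have hPS := mul_le_mul_of_nonneg_left hS (partsCount_nonneg (j + 5) n)
  have hPS' := mul_le_mul_of_nonneg_right hP
    (by positivity : 0 ≤ 1 / ((j + 2).factorial * (j + 5).factorial) * ((n : ℝ) + b) ^ (j + 2))
  have hqq := mul_le_mul (hq (n + 1) (by omega)) (hq n le_rfl) (by positivity)
    (le_trans (by positivity) (hq (n + 1) (by omega)))
  have hmain := mul_add_pow_lt_mul_sub_pow (c := (j : ℝ) + 3) (t := n) (b := b) (M := 2 * j + 5)
    (by positivity) hb0 hbn (by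
      have h1 : 2 * b * (((2 * j + 5 : ℕ) : ℝ) + 1) * ((j : ℝ) + 3 + 1) ≤
          2 * b * (2 * ((j : ℝ) + 5)) * ((j : ℝ) + 5) := by
        gcongr 2 * b * ?_ * ?_
        · push_cast
          linarith
        · linarith
      have h2 : 2 * b * (2 * ((j : ℝ) + 5)) * ((j : ℝ) + 5) = 40 * ((j : ℝ) + 5) ^ 4 := by
        rw [hb]; ring
      linarith)
  have hfac : 0 < 1 / (((j : ℝ) + 4) * ((j + 3).factorial : ℝ) ^ 2 *
      ((j + 5).factorial : ℝ) ^ 2) := by positivity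
  have hlt : 1 / ((j + 4).factorial * (j + 5).factorial) * ((n : ℝ) + b) ^ (j + 4) *
      (1 / ((j + 2).factorial * (j + 5).factorial) * ((n : ℝ) + b) ^ (j + 2)) <
      1 / ((j + 3).factorial * (j + 5).factorial) * ((n : ℝ) - b) ^ (j + 3) *
        (1 / ((j + 3).factorial * (j + 5).factorial) * ((n : ℝ) - b) ^ (j + 3)) := by
    have h := mul_lt_mul_of_pos_left hmain hfac
    refine lt_of_eq_of_lt ?_ (lt_of_lt_of_eq h ?_)
    · rw [Nat.factorial_succ (j + 3), Nat.factorial_succ (j + 2)]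
      push_cast
      field_simp
      ring
    · field_simp
      ring
  have hid : partsCount (j + 5) n ^ 2 -
      partsCount (j + 5) (n + 1) * partsCount (j + 5) (n - 1) =
      partsDiff (j + 5) (n + 1) * partsDiff (j + 5) n -
        partsCount (j + 5) n * partsDiff₂ (j + 5) (n + 1) := by
    simp only [partsDiff₂, partsDiff, add_sub_cancel_right]
    ring
  linarith

theorem stmt12 (k : ℕ) (hk : 5 ≤ k) :
    ∀ n : ℕ,
      432 * (k : ℝ) ^ (k + 5) * (Nat.factorial (k - 1) : ℝ) * Real.exp (1 / (k : ℝ)) < (n : ℝ) →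
      pA (fun i => i + 1) k ((n : ℤ) + 1) * pA (fun i => i + 1) k ((n : ℤ) - 1) <
        pA (fun i => i + 1) k (n : ℤ) ^ 2 := by
  intro n hn
  have hk1 : (1 : ℝ) ≤ k := by exact_mod_cast (by omega : 1 ≤ k)
  have hf : (1 : ℝ) ≤ (Nat.factorial (k - 1) : ℝ) := by
    exact_mod_cast Nat.factorial_pos (k - 1)
  have he : (1 : ℝ) ≤ Real.exp (1 / (k : ℝ)) := Real.one_le_exp (by positivity)
  have hn' : 40 * (k : ℝ) ^ 4 ≤ n := by
    calc 40 * (k : ℝ) ^ 4 ≤ 432 * (k : ℝ) ^ (k + 5) * 1 * 1 := by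
          rw [mul_one, mul_one]
          gcongr
          · norm_num
          · omega
      _ ≤ 432 * (k : ℝ) ^ (k + 5) * (Nat.factorial (k - 1) : ℝ) * Real.exp (1 / (k : ℝ)) := by
          gcongr
      _ ≤ n := hn.le
  obtain ⟨j, rfl⟩ := Nat.exists_eq_add_of_le' hk
  have h := partsCount_mul_lt_sq j n (by push_cast at hn' ⊢; exact hn')
  unfold partsCount at h
  exact_mod_cast h
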